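/- Let U = (1/√2)·[[1, i],[i, 1]], e₀ = (1,0) ∈ ℂ², and for a string γ : {0,…,4q} → {0,1} let C_γ be its class operator and f(γ) its number of flips. For every q ≥ 1: (i) the number of strings γ of length 4q+1 with γ(0) = 0 and f(γ) = 2q is C(4q, 2q), and C(4q, 2q) > 2^{2q}; (ii) every such string satisfies C_γ e₀ = 2^{−2q} · (−1)^q · e₀; (iii) consequently there exists a set Γ₂ of 2^{2q} such strings with ∑_{γ ∈ Γ₂} C_γ e₀ = (−1)^q e₀, which equals U^{4q} e₀, the unrestricted evolution of e₀ over 4q time steps. -/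

import Mathlib

open Matrix

/-- The single-step unitary `U = (1/√2)·[[1, i],[i, 1]]`. -/
noncomputable def Umat : Matrix (Fin 2) (Fin 2) ℂ :=
  ((Real.sqrt 2 : ℂ))⁻¹ • !![1, Complex.I; Complex.I, 1]

/-- The projections `P₀, P₁` onto the standard basis vectors of `ℂ²`. -/
def Pmat : Fin 2 → Matrix (Fin 2) (Fin 2) ℂ :=
  fun s => if s = 0 then !![1, 0; 0, 0] else !![0, 0; 0, 1]

/-- The class operator `C_γ = P_{γ(m-1)} U P_{γ(m-2)} U ⋯ U P_{γ(0)}` of a binary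
string `γ` of length `m + 1`. -/
noncomputable def classOp : {m : ℕ} → (Fin (m + 1) → Fin 2) → Matrix (Fin 2) (Fin 2) ℂ
  | 0, γ => Pmat (γ 0)
  | (m + 1), γ =>
      Pmat (γ (Fin.last (m + 1))) * Umat * classOp (fun i : Fin (m + 1) => γ i.castSucc)

/-- The number of flips of a binary string `γ` of length `m + 1`: the number of indices
`r ≤ m - 1` with `γ (r+1) ≠ γ r`. -/
def flips {m : ℕ} (γ : Fin (m + 1) → Fin 2) : ℕ :=
  (Finset.univ.filter (fun r : Fin m => γ r.succ ≠ γ r.castSucc)).card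

/-- The standard basis vector `e₀ = (1, 0)` of `ℂ²`. -/
def e0 : Fin 2 → ℂ := ![1, 0]

theorem flips_succ {m : ℕ} (γ : Fin (m + 2) → Fin 2) :
    flips γ = flips (fun i : Fin (m + 1) => γ i.castSucc) +
      if γ (Fin.last (m + 1)) ≠ γ (Fin.last m).castSucc then 1 else 0 := by
  simp only [flips, Finset.card_filter, Fin.sum_univ_castSucc, Fin.succ_last, Fin.succ_castSucc]

/-- A string is determined by its first letter and the positions of its flips. -/
theorem eq_of_flip_iff {m : ℕ} {γ δ : Fin (m + 1) → Fin 2} (h0 : γ 0 = δ 0)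
    (h : ∀ r : Fin m, γ r.succ ≠ γ r.castSucc ↔ δ r.succ ≠ δ r.castSucc) : γ = δ := by
  funext i
  induction i using Fin.induction with
  | zero => exact h0
  | succ r ih =>
    have hr := h r
    rw [ih] at hr
    generalize γ r.succ = a at *
    generalize δ r.succ = b at *
    generalize δ r.castSucc = c at *
    clear h h0 ih
    revert a b c
    decide

/-- Strings of length `m + 1` starting with `0` and having `k` flips correspond to the
`k`-element sets of flip positions. -/
theorem card_filter_flips_eq (m k : ℕ) :
    (Finset.univ.filter (fun γ : Fin (m + 1) → Fin 2 => γ 0 = 0 ∧ flips γ = k)).card =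
      Nat.choose m k := by
  have hcard : (Finset.powersetCard k (Finset.univ : Finset (Fin m))).card = Nat.choose m k := by
    simp
  rw [← hcard]
  refine Finset.card_bij
    (fun γ _ => Finset.univ.filter (fun r : Fin m => γ r.succ ≠ γ r.castSucc)) ?_ ?_ ?_
  · intro γ hγ
    simp only [Finset.mem_filter, Finset.mem_univ, true_and] at hγ
    exact Finset.mem_powersetCard.2 ⟨Finset.subset_univ _, hγ.2⟩
  · intro γ hγ δ hδ h
    simp only [Finset.mem_filter, Finset.mem_univ, true_and] at hγ hδ
    refine eq_of_flip_iff (hγ.1.trans hδ.1.symm) fun r => ?_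
    simpa using Finset.ext_iff.1 h r
  · intro S hS
    let γ : Fin (m + 1) → Fin 2 :=
      Fin.induction 0 (fun r x => if r ∈ S then x + 1 else x)
    have hγ : Finset.univ.filter (fun r : Fin m => γ r.succ ≠ γ r.castSucc) = S := by
      ext r
      have hr : γ r.succ = if r ∈ S then γ r.castSucc + 1 else γ r.castSucc :=
        Fin.induction_succ _ _ _
      by_cases h : r ∈ S <;> simp [hr, h]
    refine ⟨γ, ?_, hγ⟩
    simp only [Finset.mem_filter, Finset.mem_univ, true_and]
    refine ⟨rfl, ?_⟩
    rw [flips, hγ]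
    exact (Finset.mem_powersetCard.1 hS).2

theorem two_pow_lt_centralBinom {n : ℕ} (hn : 2 ≤ n) : 2 ^ n < Nat.centralBinom n := by
  induction n, hn using Nat.le_induction with
  | base => decide
  | succ n hn ih =>
    have h := Nat.succ_mul_centralBinom_succ n
    rw [pow_succ]
    nlinarith

theorem Pmat_Umat_mulVec_single (s t : Fin 2) :
    (Pmat t * Umat).mulVec (Pi.single s 1) =
      ((Real.sqrt 2 : ℂ)⁻¹ * Complex.I ^ (if t ≠ s then 1 else 0)) •
        (Pi.single t 1 : Fin 2 → ℂ) := by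
  funext i
  fin_cases s <;> fin_cases t <;> fin_cases i <;>
    simp [Pmat, Umat]

/-- A string with `γ 0 = 0` sends `e₀` to the basis vector of its last letter, with a factor
`1/√2` for each step and a factor `i` for each flip. -/
theorem classOp_mulVec_e0 {m : ℕ} (γ : Fin (m + 1) → Fin 2) (h0 : γ 0 = 0) :
    (classOp γ).mulVec e0 =
      ((Real.sqrt 2 : ℂ)⁻¹ ^ m * Complex.I ^ flips γ) •
        (Pi.single (γ (Fin.last m)) 1 : Fin 2 → ℂ) := by
  induction m with
  | zero =>
    funext i
    fin_cases i <;> simp [classOp, h0, Pmat, e0, flips]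
  | succ m ih =>
    rw [classOp, ← Matrix.mulVec_mulVec, ih _ h0, Matrix.mulVec_smul, Pmat_Umat_mulVec_single,
      smul_smul, flips_succ, pow_succ, pow_add]
    congr 1
    ring

theorem last_eq_flips {m : ℕ} (γ : Fin (m + 1) → Fin 2) (h0 : γ 0 = 0) :
    γ (Fin.last m) = Fin.ofNat 2 (flips γ) := by
  induction m with
  | zero => simpa [flips] using h0
  | succ m ih =>
    have h := ih (fun i => γ i.castSucc) h0
    rw [flips_succ]
    generalize γ (Fin.last (m + 1)) = a at *
    generalize flips (fun i : Fin (m + 1) => γ i.castSucc) = n at *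
    rw [h]
    fin_cases a <;> rcases Nat.mod_two_eq_zero_or_one n with hn | hn <;>
      simp [Fin.ofNat, Nat.add_mod, hn]

theorem inv_sqrt_two_sq : ((Real.sqrt 2 : ℂ)⁻¹) ^ 2 = 2⁻¹ := by
  rw [inv_pow, ← Complex.ofReal_pow, Real.sq_sqrt (by norm_num)]
  norm_num

theorem Umat_pow_four : Umat ^ 4 = -1 := by
  have h4 : ((Real.sqrt 2 : ℂ)⁻¹) ^ 4 = 4⁻¹ := by
    rw [show 4 = 2 * 2 from rfl, pow_mul, inv_sqrt_two_sq]
    norm_num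
  have hsq : (!![1, Complex.I; Complex.I, 1] : Matrix (Fin 2) (Fin 2) ℂ) ^ 2 =
      (2 * Complex.I) • !![0, 1; 1, 0] := by
    ext i j
    fin_cases i <;> fin_cases j <;> simp [pow_two] <;> ring
  have hswap : (!![0, 1; 1, 0] : Matrix (Fin 2) (Fin 2) ℂ) ^ 2 = 1 := by
    ext i j
    fin_cases i <;> fin_cases j <;> simp [pow_two]
  rw [Umat, smul_pow, h4, show 4 = 2 * 2 from rfl, pow_mul, hsq, smul_pow, hswap, smul_smul,
    mul_pow, Complex.I_sq]
  norm_num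

/-- For every `q ≥ 1`, among binary strings `γ` of length `4q + 1`:
(i) the number of strings with `γ 0 = 0` and exactly `2q` flips is `C(4q, 2q)`, which
exceeds `2^(2q)`; (ii) each such string has `C_γ e₀ = 2^(-2q) (-1)^q e₀`; (iii) hence
there is a set `Γ₂` of `2^(2q)` such strings with `∑_{γ ∈ Γ₂} C_γ e₀ = (-1)^q e₀`, which
equals the unrestricted evolution `U^(4q) e₀`. -/
theorem statement15 (q : ℕ) (hq : 1 ≤ q) :
    ((Finset.univ.filter
        (fun γ : Fin (4 * q + 1) → Fin 2 => γ 0 = 0 ∧ flips γ = 2 * q)).card =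
          Nat.choose (4 * q) (2 * q) ∧
      2 ^ (2 * q) < Nat.choose (4 * q) (2 * q)) ∧
    (∀ γ : Fin (4 * q + 1) → Fin 2, γ 0 = 0 → flips γ = 2 * q →
      (classOp γ).mulVec e0 = (((2 : ℂ) ^ (2 * q))⁻¹ * (-1 : ℂ) ^ q) • e0) ∧
    (∃ Γ₂ : Finset (Fin (4 * q + 1) → Fin 2),
      Γ₂.card = 2 ^ (2 * q) ∧
      (∀ γ ∈ Γ₂, γ 0 = 0 ∧ flips γ = 2 * q) ∧
      ∑ γ ∈ Γ₂, (classOp γ).mulVec e0 = ((-1 : ℂ) ^ q) • e0 ∧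
      ((-1 : ℂ) ^ q) • e0 = (Umat ^ (4 * q)).mulVec e0) := by
  have hcard := card_filter_flips_eq (4 * q) (2 * q)
  have hlt : 2 ^ (2 * q) < Nat.choose (4 * q) (2 * q) := by
    have h := two_pow_lt_centralBinom (n := 2 * q) (by omega)
    rwa [Nat.centralBinom_eq_two_mul_choose, show 2 * (2 * q) = 4 * q by ring] at h
  have hclass : ∀ γ : Fin (4 * q + 1) → Fin 2, γ 0 = 0 → flips γ = 2 * q →
      (classOp γ).mulVec e0 = (((2 : ℂ) ^ (2 * q))⁻¹ * (-1 : ℂ) ^ q) • e0 := by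
    intro γ h0 hγ
    have hlast : γ (Fin.last (4 * q)) = 0 := by
      rw [last_eq_flips γ h0, hγ]
      simp [Fin.ofNat]
    have he0 : (Pi.single 0 1 : Fin 2 → ℂ) = e0 := by
      funext i
      fin_cases i <;> simp [e0]
    rw [classOp_mulVec_e0 γ h0, hγ, hlast, he0, show 4 * q = 2 * (2 * q) by ring, pow_mul,
      inv_sqrt_two_sq, pow_mul Complex.I, Complex.I_sq, inv_pow]
  refine ⟨⟨hcard, hlt⟩, hclass, ?_⟩
  obtain ⟨Γ, hΓ, hΓcard⟩ := Finset.exists_subset_card_eq (hlt.le.trans_eq hcard.symm)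
  have hmem : ∀ γ ∈ Γ, γ 0 = 0 ∧ flips γ = 2 * q := fun γ hγ => by simpa using hΓ hγ
  refine ⟨Γ, hΓcard, hmem, ?_, ?_⟩
  · rw [Finset.sum_congr rfl fun γ hγ => hclass γ (hmem γ hγ).1 (hmem γ hγ).2,
      Finset.sum_const, hΓcard, ← Nat.cast_smul_eq_nsmul ℂ, smul_smul, ← mul_assoc]
    push_cast
    rw [mul_inv_cancel₀ (pow_ne_zero _ two_ne_zero), one_mul]
  · have hU : Umat ^ (4 * q) = ((-1 : ℂ) ^ q) • (1 : Matrix (Fin 2) (Fin 2) ℂ) := by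
      rw [pow_mul, Umat_pow_four, ← neg_one_smul ℂ (1 : Matrix (Fin 2) (Fin 2) ℂ), smul_pow,
        one_pow]
    rw [hU, Matrix.smul_mulVec, Matrix.one_mulVec]
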